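/- For n ≥ 5, eqdim(R''_n) ≥ 3n, and for even n, eqdim(R''_n) = 3n with {a_i, b_i, c_i : i = 0,…,n−1} a distance-equalizer set. -/

import Mathlib

/-- `S` is a distance-equalizer set of `G`. -/
def IsDistEqSet {V : Type*} (G : SimpleGraph V) (S : Set V) : Prop :=
  ∀ u v : V, u ∉ S → v ∉ S → u ≠ v → ∃ x ∈ S, G.dist u x = G.dist v x

/-- The equidistant dimension of `G`. -/
noncomputable def eqdim {V : Type*} (G : SimpleGraph V) : ℕ :=
  sInf {k | ∃ S : Finset V, IsDistEqSet G ↑S ∧ S.card = k}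

/-- The convex polytope graph `R''_n` on vertex layers a=0, b=1, c=2, d=3, e=4, f=5. -/
def R2Graph (n : ℕ) : SimpleGraph (Fin 6 × ZMod n) :=
  SimpleGraph.fromRel (fun x y =>
    (x.1 = 0 ∧ y.1 = 0 ∧ y.2 = x.2 + 1) ∨
    (x.1 = 5 ∧ y.1 = 5 ∧ y.2 = x.2 + 1) ∨
    (x.1 = 0 ∧ y.1 = 1 ∧ y.2 = x.2) ∨
    (x.1 = 2 ∧ y.1 = 3 ∧ y.2 = x.2) ∨
    (x.1 = 4 ∧ y.1 = 5 ∧ y.2 = x.2) ∨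
    (x.1 = 1 ∧ y.1 = 2 ∧ y.2 = x.2) ∨
    (x.1 = 1 ∧ y.1 = 2 ∧ x.2 = y.2 + 1) ∨
    (x.1 = 3 ∧ y.1 = 4 ∧ y.2 = x.2) ∨
    (x.1 = 3 ∧ y.1 = 4 ∧ x.2 = y.2 + 1))

namespace R2Graph

/-- Twice the angular coordinate of the index-zero vertex of each layer. -/
def offset : Fin 6 → ℕ
  | 0 | 1 => 0
  | 2 | 3 => 1
  | 4 | 5 => 2

theorem offset_le (l : Fin 6) : offset l ≤ 2 := by
  fin_cases l <;> decide

/-- Distance between vertices of two layers at horizontal separation `δ` in the infinite strip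
covering the graph. -/
def stripDist : Fin 6 → Fin 6 → ℕ → ℕ
  | 0, 0, δ => δ / 2
  | 0, 1, δ => 1 + δ / 2
  | 0, 2, δ => 2 + δ / 2
  | 0, 3, δ => 3 + δ / 2
  | 0, 4, δ => max 4 (3 + δ / 2)
  | 0, 5, δ => max 5 (4 + δ / 2)
  | 1, 0, δ => 1 + δ / 2
  | 1, 1, δ => min δ (δ / 2 + 2)
  | 1, 2, δ => min δ (δ / 2 + 3)
  | 1, 3, δ => min (δ + 1) (δ / 2 + 4)
  | 1, 4, δ => min (max 3 (δ + 1)) (δ / 2 + 4)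
  | 1, 5, δ => max 4 (3 + δ / 2)
  | 2, 0, δ => 2 + δ / 2
  | 2, 1, δ => min δ (δ / 2 + 3)
  | 2, 2, δ => min δ (δ / 2 + 3)
  | 2, 3, δ => min (δ + 1) (δ / 2 + 4)
  | 2, 4, δ => min (δ + 1) (δ / 2 + 4)
  | 2, 5, δ => 3 + δ / 2
  | 3, 0, δ => 3 + δ / 2
  | 3, 1, δ => min (δ + 1) (δ / 2 + 4)
  | 3, 2, δ => min (δ + 1) (δ / 2 + 4)
  | 3, 3, δ => min δ (δ / 2 + 3)
  | 3, 4, δ => min δ (δ / 2 + 3)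
  | 3, 5, δ => 2 + δ / 2
  | 4, 0, δ => max 4 (3 + δ / 2)
  | 4, 1, δ => min (max 3 (δ + 1)) (δ / 2 + 4)
  | 4, 2, δ => min (δ + 1) (δ / 2 + 4)
  | 4, 3, δ => min δ (δ / 2 + 3)
  | 4, 4, δ => min δ (δ / 2 + 2)
  | 4, 5, δ => 1 + δ / 2
  | 5, 0, δ => max 5 (4 + δ / 2)
  | 5, 1, δ => max 4 (3 + δ / 2)
  | 5, 2, δ => 3 + δ / 2
  | 5, 3, δ => 2 + δ / 2
  | 5, 4, δ => 1 + δ / 2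
  | 5, 5, δ => δ / 2

/-- Circular horizontal separation of the vertices `(l, 0)` and `(m, t)`. -/
def separation (n : ℕ) (l m : Fin 6) (t : ℕ) : ℕ :=
  let a := (2 * t + offset m - offset l) + (offset l - (2 * t + offset m))
  min a (2 * n - a)

/-- Distance from `(l, 0)` to `(m, t)`. -/
def layerDist (n : ℕ) (l m : Fin 6) (t : ℕ) : ℕ :=
  stripDist l m (separation n l m t)

/-- The edge relation of `R2Graph n`, with the indices represented by natural numbers. -/
def Step (n : ℕ) (l : Fin 6) (s : ℕ) (m : Fin 6) (t : ℕ) : Prop :=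
  (l = 0 ∧ m = 0 ∧ (t = s + 1 ∨ s + 1 = n ∧ t = 0)) ∨
  (l = 5 ∧ m = 5 ∧ (t = s + 1 ∨ s + 1 = n ∧ t = 0)) ∨
  (l = 0 ∧ m = 1 ∧ t = s) ∨
  (l = 2 ∧ m = 3 ∧ t = s) ∨
  (l = 4 ∧ m = 5 ∧ t = s) ∨
  (l = 1 ∧ m = 2 ∧ t = s) ∨
  (l = 1 ∧ m = 2 ∧ (s = t + 1 ∨ t + 1 = n ∧ s = 0)) ∨
  (l = 3 ∧ m = 4 ∧ t = s) ∨
  (l = 3 ∧ m = 4 ∧ (s = t + 1 ∨ t + 1 = n ∧ s = 0))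

theorem separation_mod_two {n : ℕ} (k m : Fin 6) (t : ℕ) (ht : t < n) :
    separation n k m t % 2 = (offset k + offset m) % 2 := by
  have := offset_le k
  have := offset_le m
  dsimp only [separation]
  omega

theorem separation_congr (n : ℕ) (k : Fin 6) {l m : Fin 6} (h : offset l = offset m) (t : ℕ) :
    separation n k l t = separation n k m t := by
  simp only [separation, h]

theorem separation_ring {n : ℕ} (hn : 5 ≤ n) (k l : Fin 6) {s t : ℕ} (hs : s < n) (ht : t < n)
    (h : t = s + 1 ∨ s + 1 = n ∧ t = 0) :
    separation n k l t ≤ separation n k l s + 2 ∧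
      separation n k l s ≤ separation n k l t + 2 := by
  have := offset_le k
  have := offset_le l
  dsimp only [separation]
  omega

theorem separation_zigzag {n : ℕ} (hn : 5 ≤ n) (k : Fin 6) {l m : Fin 6}
    (hlm : offset m = offset l + 1) {s t : ℕ} (hs : s < n) (ht : t < n)
    (h : t = s ∨ s = t + 1 ∨ t + 1 = n ∧ s = 0) :
    separation n k m t ≤ separation n k l s + 1 ∧
      separation n k l s ≤ separation n k m t + 1 := by
  have := offset_le k
  have := offset_le m
  dsimp only [separation]
  omega

theorem separation_ring_descend {n : ℕ} (hn : 5 ≤ n) (k l : Fin 6) {p q s : ℕ}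
    (hp : p < n) (hp' : p = s + 1 ∨ s + 1 = n ∧ p = 0)
    (hq' : s = q + 1 ∨ q + 1 = n ∧ s = 0) :
    separation n k l p + 2 = separation n k l s ∨ separation n k l q + 2 = separation n k l s ∨
      separation n k l s ≤ 1 := by
  have := offset_le k
  have := offset_le l
  rcases Nat.lt_or_ge 1 (separation n k l s) with hx | hx
  · dsimp only [separation] at hx ⊢
    by_cases hside : offset k < 2 * s + offset l ∧ 2 * s + offset l ≤ offset k + n
    · refine .inr (.inl ?_)
      clear hp' hp
      rcases hq' with hq' | hq' <;> omega
    · refine .inl ?_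
      clear hq'
      rcases hp' with hp' | hp' <;> omega
  · exact .inr (.inr hx)

theorem separation_zigzag_descend_up {n : ℕ} (hn : 5 ≤ n) (k : Fin 6) {l m : Fin 6}
    (hlm : offset m = offset l + 1) {q s : ℕ} (hs : s < n) (hq : q < n)
    (hq' : s = q + 1 ∨ q + 1 = n ∧ s = 0) :
    separation n k m q + 1 = separation n k l s ∨ separation n k m s + 1 = separation n k l s ∨
      separation n k l s = 0 ∧ separation n k m s ≤ 1 := by
  have := offset_le k
  have := offset_le m
  dsimp only [separation]
  omega

theorem separation_zigzag_descend_down {n : ℕ} (hn : 5 ≤ n) (k : Fin 6) {l m : Fin 6}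
    (hlm : offset l = offset m + 1) {p s : ℕ} (hs : s < n) (hp : p < n)
    (hp' : p = s + 1 ∨ s + 1 = n ∧ p = 0) :
    separation n k m p + 1 = separation n k l s ∨ separation n k m s + 1 = separation n k l s ∨
      separation n k l s = 0 ∧ separation n k m s ≤ 1 := by
  have := offset_le k
  have := offset_le l
  dsimp only [separation]
  omega

theorem eq_zero_of_separation_eq_zero {n : ℕ} (l : Fin 6) {s : ℕ} (hs : s < n)
    (h : separation n l l s = 0) : s = 0 := by
  dsimp only [separation] at h
  omega

theorem layerDist_step {n : ℕ} (hn : 5 ≤ n) (k : Fin 6) {l m : Fin 6} {s t : ℕ} (hs : s < n)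
    (ht : t < n) (h : Step n l s m t) :
    layerDist n k m t ≤ layerDist n k l s + 1 ∧ layerDist n k l s ≤ layerDist n k m t + 1 := by
  have hx := separation_mod_two k l s hs
  have hy := separation_mod_two k m t ht
  have ring := separation_ring hn k l hs ht
  have rung (hlm : offset l = offset m) (h : t = s) :
      separation n k l s = separation n k m t := h ▸ separation_congr n k hlm s
  have zigzag (hlm : offset m = offset l + 1) := separation_zigzag hn k hlm hs ht
  unfold layerDist
  rcases h with ⟨rfl, rfl, h⟩ | ⟨rfl, rfl, h⟩ | ⟨rfl, rfl, h⟩ | ⟨rfl, rfl, h⟩ | ⟨rfl, rfl, h⟩ |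
    ⟨rfl, rfl, h⟩ | ⟨rfl, rfl, h⟩ | ⟨rfl, rfl, h⟩ | ⟨rfl, rfl, h⟩
  on_goal 1 => have := ring h
  on_goal 2 => have := ring h
  on_goal 3 => have := rung rfl h
  on_goal 4 => have := rung rfl h
  on_goal 5 => have := rung rfl h
  on_goal 6 => have := zigzag rfl (.inl h)
  on_goal 7 => have := zigzag rfl (.inr h)
  on_goal 8 => have := zigzag rfl (.inl h)
  on_goal 9 => have := zigzag rfl (.inr h)
  all_goals
    clear ring rung zigzag h
    generalize separation n k _ s = x at *
    generalize separation n k _ t = y at *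
    fin_cases k <;> dsimp only [stripDist, offset] at hx hy ⊢ <;> omega

theorem layerDist_descend {n : ℕ} (hn : 5 ≤ n) (k l : Fin 6) {s : ℕ} (hs : s < n)
    (h : ¬ (l = k ∧ s = 0)) :
    ∃ m t, t < n ∧ (Step n l s m t ∨ Step n m t l s) ∧ layerDist n k m t < layerDist n k l s := by
  obtain ⟨p, hp, hp'⟩ : ∃ p < n, p = s + 1 ∨ s + 1 = n ∧ p = 0 := by
    by_cases h : s + 1 = n
    · exact ⟨0, by omega, by omega⟩
    · exact ⟨s + 1, by omega, by omega⟩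
  obtain ⟨q, hq, hq'⟩ : ∃ q < n, s = q + 1 ∨ q + 1 = n ∧ s = 0 := by
    by_cases h : s = 0
    · exact ⟨n - 1, by omega, by omega⟩
    · exact ⟨s - 1, by omega, by omega⟩
  have parity := separation_mod_two k l s hs
  have hpos : k = l → separation n k l s ≠ 0 := by
    rintro rfl h0
    exact h ⟨rfl, eq_zero_of_separation_eq_zero k hs h0⟩
  have ring := separation_ring_descend hn k l hp hp' hq'
  have up (m) (hm : offset m = offset l + 1) := separation_zigzag_descend_up hn k hm hs hq hq'
  have down (m) (hm : offset l = offset m + 1) :=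
    separation_zigzag_descend_down hn k hm hs hp hp'
  have rung (m) (hm : offset m = offset l) := separation_congr n k hm s
  by_contra! H
  unfold layerDist at H
  obtain rfl | rfl | rfl | rfl | rfl | rfl : l = 0 ∨ l = 1 ∨ l = 2 ∨ l = 3 ∨ l = 4 ∨ l = 5 := by
    omega
  · have h1 := H 0 p hp (by simp [Step, hp'])
    have h2 := H 0 q hq (by simp [Step, hq'])
    have h3 := H 1 s hs (by simp [Step])
    rw [rung 1 rfl] at h3
    clear H rung up down h hp' hq' hp hq hs hn
    generalize separation n k 0 p = y at *
    generalize separation n k 0 q = z at *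
    generalize separation n k 0 s = x at *
    fin_cases k <;>
      dsimp only [stripDist, offset] at parity h1 h2 h3 <;> simp at hpos <;> omega
  · have h1 := H 0 s hs (by simp [Step])
    have h2 := H 2 q hq (by simp [Step, hq'])
    have h3 := H 2 s hs (by simp [Step])
    rw [rung 0 rfl] at h1
    have := up 2 rfl
    clear H rung up down ring h hp' hq' hp hq hs hn
    generalize separation n k 2 q = y at *
    generalize separation n k 2 s = z at *
    generalize separation n k 1 s = x at *
    fin_cases k <;>
      dsimp only [stripDist, offset] at parity h1 h2 h3 <;> simp at hpos <;> omega
  · have h1 := H 1 p hp (by simp [Step, hp'])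
    have h2 := H 1 s hs (by simp [Step])
    have h3 := H 3 s hs (by simp [Step])
    rw [rung 3 rfl] at h3
    have := down 1 rfl
    clear H rung up down ring h hp' hq' hp hq hs hn
    generalize separation n k 1 p = y at *
    generalize separation n k 1 s = z at *
    generalize separation n k 2 s = x at *
    fin_cases k <;>
      dsimp only [stripDist, offset] at parity h1 h2 h3 <;> simp at hpos <;> omega
  · have h1 := H 2 s hs (by simp [Step])
    have h2 := H 4 q hq (by simp [Step, hq'])
    have h3 := H 4 s hs (by simp [Step])
    rw [rung 2 rfl] at h1
    have := up 4 rfl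
    clear H rung up down ring h hp' hq' hp hq hs hn
    generalize separation n k 4 q = y at *
    generalize separation n k 4 s = z at *
    generalize separation n k 3 s = x at *
    fin_cases k <;>
      dsimp only [stripDist, offset] at parity h1 h2 h3 <;> simp at hpos <;> omega
  · have h1 := H 3 p hp (by simp [Step, hp'])
    have h2 := H 3 s hs (by simp [Step])
    have h3 := H 5 s hs (by simp [Step])
    rw [rung 5 rfl] at h3
    have := down 3 rfl
    clear H rung up down ring h hp' hq' hp hq hs hn
    generalize separation n k 3 p = y at *
    generalize separation n k 3 s = z at *
    generalize separation n k 4 s = x at *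
    fin_cases k <;>
      dsimp only [stripDist, offset] at parity h1 h2 h3 <;> simp at hpos <;> omega
  · have h1 := H 5 p hp (by simp [Step, hp'])
    have h2 := H 5 q hq (by simp [Step, hq'])
    have h3 := H 4 s hs (by simp [Step])
    rw [rung 4 rfl] at h3
    clear H rung up down h hp' hq' hp hq hs hn
    generalize separation n k 5 p = y at *
    generalize separation n k 5 q = z at *
    generalize separation n k 5 s = x at *
    fin_cases k <;>
      dsimp only [stripDist, offset] at parity h1 h2 h3 <;> simp at hpos <;> omega

theorem layerDist_self (n : ℕ) (l : Fin 6) : layerDist n l l 0 = 0 := by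
  fin_cases l <;> simp [layerDist, stripDist, separation, offset]

/-- The midpoint of two vertices of the same outer layer is equidistant from them. -/
theorem exists_layerDist_eq_self {n : ℕ} (hn : 5 ≤ n) (l : Fin 6) (hl : 3 ≤ l) {w : ℕ}
    (hw : w < n) : ∃ m : Fin 6, m ≤ 2 ∧ ∃ t < n, ∀ s < n, (s + w = t ∨ s + w = t + n) →
      layerDist n l m t = layerDist n l m s := by
  fin_cases l <;> simp at hl
  · rcases Nat.even_or_odd' w with ⟨c, rfl | rfl⟩
    · refine ⟨2, by simp, c, by omega, fun s hs h => ?_⟩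
      dsimp only [layerDist, stripDist, separation, offset]; omega
    · refine ⟨0, by simp, c + 1, by omega, fun s hs h => ?_⟩
      dsimp only [layerDist, stripDist, separation, offset]; omega
  all_goals
    rcases Nat.even_or_odd' w with ⟨c, rfl | rfl⟩
    · refine ⟨0, by simp, c + 1, by omega, fun s hs h => ?_⟩
      dsimp only [layerDist, stripDist, separation, offset]; omega
    · refine ⟨2, by simp, c + 1, by omega, fun s hs h => ?_⟩
      dsimp only [layerDist, stripDist, separation, offset]; omega

theorem exists_layerDist_eq_three_four {n : ℕ} (hn : 5 ≤ n) (he : Even n) {w : ℕ}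
    (hw : w < n) : ∃ m : Fin 6, m ≤ 2 ∧ ∃ t < n, ∀ s < n, (s + w = t ∨ s + w = t + n) →
      layerDist n 3 m t = layerDist n 4 m s := by
  obtain ⟨N, rfl⟩ := he
  rcases Nat.even_or_odd' w with ⟨c, rfl | rfl⟩
  · refine ⟨0, by simp, if c = 0 then 2 else c + 1, by split_ifs <;> omega, fun s hs h => ?_⟩
    dsimp only [layerDist, stripDist, separation, offset]; split_ifs at * <;> omega
  · refine ⟨0, by simp, if c + 1 = N then 2 * c + 1 else N + c + 1, by split_ifs <;> omega,
      fun s hs h => ?_⟩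
    dsimp only [layerDist, stripDist, separation, offset]; split_ifs at * <;> omega

theorem exists_layerDist_eq_three_five {n : ℕ} (hn : 5 ≤ n) (he : Even n) {w : ℕ}
    (hw : w < n) : ∃ m : Fin 6, m ≤ 2 ∧ ∃ t < n, ∀ s < n, (s + w = t ∨ s + w = t + n) →
      layerDist n 3 m t = layerDist n 5 m s := by
  obtain ⟨N, rfl⟩ := he
  rcases Nat.even_or_odd' w with ⟨c, rfl | rfl⟩
  · by_cases hc : c = 0
    · refine ⟨1, by simp, 2, by omega, fun s hs h => ?_⟩
      dsimp only [layerDist, stripDist, separation, offset]; omega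
    · refine ⟨0, by simp, if c + 1 = N then 2 * c else N + c, by split_ifs <;> omega,
        fun s hs h => ?_⟩
      dsimp only [layerDist, stripDist, separation, offset]; split_ifs at * <;> omega
  · by_cases hc : c + 1 = N
    · refine ⟨1, by simp, 3, by omega, fun s hs h => ?_⟩
      dsimp only [layerDist, stripDist, separation, offset]; omega
    · refine ⟨0, by simp, if c = 0 then 3 else c + 2, by split_ifs <;> omega, fun s hs h => ?_⟩
      dsimp only [layerDist, stripDist, separation, offset]; split_ifs at * <;> omega

theorem exists_layerDist_eq_four_five {n : ℕ} (hn : 5 ≤ n) (he : Even n) {w : ℕ}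
    (hw : w < n) : ∃ m : Fin 6, m ≤ 2 ∧ ∃ t < n, ∀ s < n, (s + w = t ∨ s + w = t + n) →
      layerDist n 4 m t = layerDist n 5 m s := by
  obtain ⟨N, rfl⟩ := he
  rcases Nat.even_or_odd' w with ⟨c, rfl | rfl⟩
  · by_cases hc : c = 1
    · refine ⟨0, by simp, 3, by omega, fun s hs h => ?_⟩
      dsimp only [layerDist, stripDist, separation, offset]; omega
    by_cases hc : c ≤ 2
    · refine ⟨1, by simp, 3, by omega, fun s hs h => ?_⟩
      dsimp only [layerDist, stripDist, separation, offset]; omega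
    · refine ⟨2, by simp, c, by omega, fun s hs h => ?_⟩
      dsimp only [layerDist, stripDist, separation, offset]; omega
  · refine ⟨0, by simp, if c = 0 then 3 else c + 2, by split_ifs <;> omega, fun s hs h => ?_⟩
    dsimp only [layerDist, stripDist, separation, offset]; split_ifs at * <;> omega

theorem layerDist_zero_ne_five {n : ℕ} (hn : 5 ≤ n) (m : Fin 6) {s t : ℕ} (hs : s < n)
    (ht : t < n) (h : s = t + 1 ∨ t + 1 = n ∧ s = 0) :
    layerDist n 0 m t ≠ layerDist n 5 m s := by
  fin_cases m <;> dsimp only [layerDist, stripDist, separation, offset] <;> omega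

theorem layerDist_one_ne_four {n : ℕ} (hn : 5 ≤ n) (m : Fin 6) {s t : ℕ} (hs : s < n)
    (ht : t < n) (h : s = t + 1 ∨ t + 1 = n ∧ s = 0) :
    layerDist n 1 m t ≠ layerDist n 4 m s := by
  fin_cases m <;> dsimp only [layerDist, stripDist, separation, offset] <;> omega

theorem layerDist_two_ne_three (n : ℕ) (m : Fin 6) {t : ℕ} (ht : t < n) :
    layerDist n 2 m t ≠ layerDist n 3 m t := by
  fin_cases m <;> dsimp only [layerDist, stripDist, separation, offset] <;> omega

end R2Graph

theorem SimpleGraph.dist_eq_of_descend {V : Type*} {G : SimpleGraph V} {u : V} {f : V → ℕ}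
    (h0 : f u = 0) (hstep : ∀ x y, G.Adj x y → f y ≤ f x + 1)
    (hdesc : ∀ x, x ≠ u → ∃ y, G.Adj x y ∧ f y < f x) (x : V) : G.dist u x = f x := by
  have lower : ∀ {a b : V} (p : G.Walk a b), f b ≤ f a + p.length := by
    intro a b p
    induction p with
    | nil => simp
    | cons h p ih =>
      have := hstep _ _ h
      rw [SimpleGraph.Walk.length_cons]
      omega
  have upper : ∀ k x, f x ≤ k → ∃ p : G.Walk u x, p.length ≤ f x := by
    intro k
    induction k with
    | zero =>
      intro x hx
      by_cases hxu : x = u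
      · subst hxu; exact ⟨.nil, by simp⟩
      · obtain ⟨y, -, hy⟩ := hdesc x hxu
        omega
    | succ k ih =>
      intro x hx
      by_cases hxu : x = u
      · subst hxu; exact ⟨.nil, by simp⟩
      · obtain ⟨y, hadj, hy⟩ := hdesc x hxu
        obtain ⟨p, hp⟩ := ih y (by omega)
        refine ⟨p.concat hadj.symm, ?_⟩
        rw [SimpleGraph.Walk.length_concat]
        omega
  obtain ⟨p, hp⟩ := upper _ x le_rfl
  obtain ⟨q, hq⟩ := p.reachable.exists_walk_length_eq_dist
  have := lower q
  have := SimpleGraph.dist_le p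
  omega

theorem ZMod.val_add_cases {n : ℕ} [NeZero n] (a b : ZMod n) :
    a.val + b.val = (a + b).val ∨ a.val + b.val = (a + b).val + n := by
  rcases lt_or_ge (a.val + b.val) n with h | h
  · exact .inl (ZMod.val_add_of_lt h).symm
  · exact .inr (ZMod.val_add_val_of_le h)

theorem ZMod.eq_add_one_iff_val {n : ℕ} [NeZero n] (hn : 1 < n) (a b : ZMod n) :
    b = a + 1 ↔ b.val = a.val + 1 ∨ a.val + 1 = n ∧ b.val = 0 := by
  have : Fact (1 < n) := ⟨hn⟩
  have h := ZMod.val_add_cases a 1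
  rw [ZMod.val_one] at h
  have h0 := a.val_lt
  have h1 := (a + 1).val_lt
  have h2 := b.val_lt
  rw [← (ZMod.val_injective n).eq_iff]
  omega

namespace R2Graph

theorem adj_iff {n : ℕ} (hn : 5 ≤ n) (u x y : Fin 6 × ZMod n) :
    (R2Graph n).Adj x y ↔ Step n x.1 (x.2 - u.2).val y.1 (y.2 - u.2).val ∨
      Step n y.1 (y.2 - u.2).val x.1 (x.2 - u.2).val := by
  have : NeZero n := ⟨by omega⟩
  have key : ∀ a b : ZMod n, b = a + 1 ↔ (b - u.2).val = (a - u.2).val + 1 ∨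
      (a - u.2).val + 1 = n ∧ (b - u.2).val = 0 := by
    intro a b
    rw [← ZMod.eq_add_one_iff_val (by omega)]
    constructor <;> intro h <;> linear_combination h
  have key' : ∀ a b : ZMod n, b = a ↔ (b - u.2).val = (a - u.2).val := by
    intro a b
    rw [(ZMod.val_injective n).eq_iff]
    exact sub_left_inj.symm
  rw [R2Graph, SimpleGraph.fromRel_adj]
  simp only [Step, ← key, ← key']
  refine and_iff_right_of_imp ?_
  have h1 : (1 : ZMod n) ≠ 0 := by
    have : Fact (1 < n) := ⟨by omega⟩
    exact one_ne_zero
  clear key key'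
  rintro h rfl
  rcases h with h | h <;>
  rcases h with ⟨h, h', h''⟩ | ⟨h, h', h''⟩ | ⟨h, h', h''⟩ | ⟨h, h', h''⟩ | ⟨h, h', h''⟩ |
    ⟨h, h', h''⟩ | ⟨h, h', h''⟩ | ⟨h, h', h''⟩ | ⟨h, h', h''⟩ <;> simp_all

theorem dist_eq_layerDist {n : ℕ} (hn : 5 ≤ n) (u x : Fin 6 × ZMod n) :
    (R2Graph n).dist u x = layerDist n u.1 x.1 (x.2 - u.2).val := by
  have : NeZero n := ⟨by omega⟩
  refine SimpleGraph.dist_eq_of_descend (f := fun x => layerDist n u.1 x.1 (x.2 - u.2).val)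
    ?_ ?_ ?_ x
  · simp [layerDist_self]
  · intro x y h
    rcases (adj_iff hn u x y).1 h with h | h
    · exact (layerDist_step hn u.1 (ZMod.val_lt _) (ZMod.val_lt _) h).1
    · exact (layerDist_step hn u.1 (ZMod.val_lt _) (ZMod.val_lt _) h).2
  · intro x hx
    obtain ⟨m, t, ht, hstep, hlt⟩ := layerDist_descend hn u.1 x.1 (ZMod.val_lt (x.2 - u.2))
      (fun ⟨h, h'⟩ => hx (Prod.ext h (sub_eq_zero.1 ((ZMod.val_eq_zero _).1 h'))))
    refine ⟨(m, u.2 + t), (adj_iff hn u _ _).2 ?_, ?_⟩ <;>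
      simpa [ZMod.val_natCast_of_lt ht]

theorem exists_dist_eq {n : ℕ} (hn : 5 ≤ n) (u v : Fin 6 × ZMod n)
    (h : ∃ m : Fin 6, m ≤ 2 ∧ ∃ t < n, ∀ s < n,
      (s + (v.2 - u.2).val = t ∨ s + (v.2 - u.2).val = t + n) →
      layerDist n u.1 m t = layerDist n v.1 m s) :
    ∃ x ∈ {x : Fin 6 × ZMod n | x.1 = 0 ∨ x.1 = 1 ∨ x.1 = 2},
      (R2Graph n).dist u x = (R2Graph n).dist v x := by
  have : NeZero n := ⟨by omega⟩
  obtain ⟨m, hm, t, ht, h⟩ := h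
  refine ⟨(m, u.2 + (t : ZMod n)), ?_, ?_⟩
  · simp only [Set.mem_ofPred_eq]
    omega
  · have hc := ZMod.val_add_cases ((u.2 + (t : ZMod n)) - v.2) (v.2 - u.2)
    rw [show (u.2 + (t : ZMod n)) - v.2 + (v.2 - u.2) = (t : ZMod n) by ring, ZMod.val_natCast_of_lt ht] at hc
    rw [dist_eq_layerDist hn, dist_eq_layerDist hn, add_sub_cancel_left,
      ZMod.val_natCast_of_lt ht]
    exact h _ (ZMod.val_lt _) hc

theorem isDistEqSet_inner {n : ℕ} (hn : 5 ≤ n) (he : Even n) :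
    IsDistEqSet (R2Graph n) {x : Fin 6 × ZMod n | x.1 = 0 ∨ x.1 = 1 ∨ x.1 = 2} := by
  have : NeZero n := ⟨by omega⟩
  intro u v hu hv _
  wlog huv : u.1 ≤ v.1 generalizing u v
  · obtain ⟨x, hx, h⟩ := this v u hv hu (Ne.symm ‹_›) (le_of_not_ge huv)
    exact ⟨x, hx, h.symm⟩
  refine exists_dist_eq hn u v ?_
  have hw := ZMod.val_lt (v.2 - u.2)
  simp only [Set.mem_ofPred_eq] at hu hv
  rcases eq_or_ne u.1 v.1 with h | h
  · rw [← h]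
    exact exists_layerDist_eq_self hn u.1 (by omega) hw
  · obtain ⟨h1, h2⟩ | ⟨h1, h2⟩ | ⟨h1, h2⟩ :
        (u.1 = 3 ∧ v.1 = 4) ∨ (u.1 = 3 ∧ v.1 = 5) ∨ (u.1 = 4 ∧ v.1 = 5) := by omega
    · rw [h1, h2]; exact exists_layerDist_eq_three_four hn he hw
    · rw [h1, h2]; exact exists_layerDist_eq_three_five hn he hw
    · rw [h1, h2]; exact exists_layerDist_eq_four_five hn he hw

theorem val_sub_eq_val_sub_add_one {n : ℕ} (hn : 5 ≤ n) (i j : ZMod n) :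
    (j - i).val = (j - (i + 1)).val + 1 ∨ (j - (i + 1)).val + 1 = n ∧ (j - i).val = 0 := by
  have : NeZero n := ⟨by omega⟩
  rw [← ZMod.eq_add_one_iff_val (by omega)]
  ring

theorem dist_zero_ne_five {n : ℕ} (hn : 5 ≤ n) (i : ZMod n) (x : Fin 6 × ZMod n) :
    (R2Graph n).dist (0, i + 1) x ≠ (R2Graph n).dist (5, i) x := by
  have : NeZero n := ⟨by omega⟩
  rw [dist_eq_layerDist hn, dist_eq_layerDist hn]
  exact layerDist_zero_ne_five hn x.1 (ZMod.val_lt _) (ZMod.val_lt _)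
    (val_sub_eq_val_sub_add_one hn i x.2)

theorem dist_one_ne_four {n : ℕ} (hn : 5 ≤ n) (i : ZMod n) (x : Fin 6 × ZMod n) :
    (R2Graph n).dist (1, i + 1) x ≠ (R2Graph n).dist (4, i) x := by
  have : NeZero n := ⟨by omega⟩
  rw [dist_eq_layerDist hn, dist_eq_layerDist hn]
  exact layerDist_one_ne_four hn x.1 (ZMod.val_lt _) (ZMod.val_lt _)
    (val_sub_eq_val_sub_add_one hn i x.2)

theorem dist_two_ne_three {n : ℕ} (hn : 5 ≤ n) (i : ZMod n) (x : Fin 6 × ZMod n) :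
    (R2Graph n).dist (2, i) x ≠ (R2Graph n).dist (3, i) x := by
  have : NeZero n := ⟨by omega⟩
  rw [dist_eq_layerDist hn, dist_eq_layerDist hn]
  exact layerDist_two_ne_three n x.1 (ZMod.val_lt _)

/-- Index of the orbit of a vertex under the reflection exchanging the inner and outer cycles. -/
def orbitIndex {n : ℕ} (x : Fin 6 × ZMod n) : Fin 3 × ZMod n :=
  (![0, 1, 2, 2, 1, 0] x.1, ![x.2 - 1, x.2 - 1, x.2, x.2, x.2, x.2] x.1)

theorem le_card_of_isDistEqSet {n : ℕ} (hn : 5 ≤ n) (S : Finset (Fin 6 × ZMod n))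
    (hS : IsDistEqSet (R2Graph n) ↑S) : 3 * n ≤ S.card := by
  have : NeZero n := ⟨by omega⟩
  have mem : ∀ u v : Fin 6 × ZMod n, u.1 ≠ v.1 →
      (∀ x, (R2Graph n).dist u x ≠ (R2Graph n).dist v x) → u ∈ S ∨ v ∈ S := by
    intro u v huv h
    by_contra! hc
    obtain ⟨x, -, hx⟩ := hS u v (by simpa using hc.1) (by simpa using hc.2)
      (fun h => huv (congrArg Prod.fst h))
    exact h x hx
  have himage : S.image orbitIndex = Finset.univ := by
    refine Finset.eq_univ_iff_forall.2 fun ⟨k, i⟩ => Finset.mem_image.2 ?_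
    fin_cases k
    · rcases mem (0, i + 1) (5, i) (by simp) (dist_zero_ne_five hn i) with h | h <;>
        exact ⟨_, h, by simp [orbitIndex]⟩
    · rcases mem (1, i + 1) (4, i) (by simp) (dist_one_ne_four hn i) with h | h <;>
        exact ⟨_, h, by simp [orbitIndex]⟩
    · rcases mem (2, i) (3, i) (by simp) (dist_two_ne_three hn i) with h | h <;>
        exact ⟨_, h, by simp [orbitIndex]⟩
  calc 3 * n = (S.image orbitIndex).card := by simp [himage, ZMod.card]
    _ ≤ S.card := Finset.card_image_le

theorem le_eqdim {n : ℕ} (hn : 5 ≤ n) : 3 * n ≤ eqdim (R2Graph n) := by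
  have : NeZero n := ⟨by omega⟩
  refine le_csInf ⟨_, Finset.univ, fun u v hu => absurd (by simp) hu, rfl⟩ ?_
  rintro _ ⟨S, hS, rfl⟩
  exact le_card_of_isDistEqSet hn S hS

theorem eqdim_le {n : ℕ} (hn : 5 ≤ n) (he : Even n) : eqdim (R2Graph n) ≤ 3 * n := by
  have : NeZero n := ⟨by omega⟩
  refine Nat.sInf_le ⟨({0, 1, 2} : Finset (Fin 6)) ×ˢ Finset.univ, ?_, ?_⟩
  · convert isDistEqSet_inner hn he using 1
    ext x
    simp
  · rw [Finset.card_product, Finset.card_univ, ZMod.card]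
    rfl

end R2Graph

theorem stmt19 (n : ℕ) (hn : 5 ≤ n) :
    3 * n ≤ eqdim (R2Graph n) ∧
    (Even n →
      IsDistEqSet (R2Graph n) {x : Fin 6 × ZMod n | x.1 = 0 ∨ x.1 = 1 ∨ x.1 = 2} ∧
      eqdim (R2Graph n) = 3 * n) :=
  ⟨R2Graph.le_eqdim hn, fun he => ⟨R2Graph.isDistEqSet_inner hn he,
    (R2Graph.eqdim_le hn he).antisymm (R2Graph.le_eqdim hn)⟩⟩
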